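/- arXiv:2202.13957 — 2 statements merged into one kernel-verified Lean document; each statement's English description precedes it below -/
import Mathlib

section
/- Let V be a finite-dimensional simple module over the algebra Q generated by x_2 and z_0,...,z_g (g ≥ 1) with relations z_n z_{n+1} = q^{-1} z_{n+1} z_n for n < g, x_2 z_n = q z_n x_2 + z_{n+1} for n < g, and x_2 z_g = q z_g x_2. Then z_g acts as zero on V. -/
/-- Applying the skew derivation `b ↦ x b - q b x` to the relation `b c = t c b`. -/
theorem skew_commute_step {k A : Type*} [Field k] [Ring A] [Algebra k A] {q t : k} (hq : q ≠ 0)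
    {x b b' c c' : A} (hb : x * b = q • (b * x) + b') (hc : x * c = q • (c * x) + c')
    (h : b * c = t • (c * b)) (h' : b' * c = (q * t) • (c * b')) :
    b * c' = (q⁻¹ * t) • (c' * b) := by
  have e1 : x * (b * c) = (q * q) • (b * c * x) + q • (b * c') + b' * c := by
    rw [← mul_assoc, hb, add_mul, smul_mul_assoc, mul_assoc b x c, hc, mul_add, smul_add,
      mul_smul_comm, smul_smul, mul_assoc b c x]
  have e2 : x * (c * b) = (q * q) • (c * b * x) + q • (c * b') + c' * b := by
    rw [← mul_assoc, hc, add_mul, smul_mul_assoc, mul_assoc c x b, hb, mul_add, smul_add,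
      mul_smul_comm, smul_smul, mul_assoc c b x]
  have e3 : q • (b * c') = t • (c' * b) := by
    rw [h, mul_smul_comm, e2, h', smul_mul_assoc] at e1
    rw [← sub_eq_zero] at e1 ⊢
    rw [← neg_eq_zero, ← e1]
    module
  rw [mul_smul, ← e3, inv_smul_smul₀ hq]

theorem skew_commute_of_adjacent {k A : Type*} [Field k] [Ring A] [Algebra k A] {q : k}
    (hq : q ≠ 0) {g : ℕ} {x : A} {z : ℕ → A}
    (hzz : ∀ n, n < g → z n * z (n + 1) = q⁻¹ • (z (n + 1) * z n))
    (hxz : ∀ n, n < g → x * z n = q • (z n * x) + z (n + 1)) (d : ℕ) :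
    ∀ n, n + d ≤ g → z n * z (n + d) = q⁻¹ ^ d • (z (n + d) * z n) := by
  induction d using Nat.twoStepInduction with
  | zero => simp
  | one => intro n hn; simpa using hzz n hn
  | more d ih ih' =>
    intro n hn
    have h := skew_commute_step hq (hxz n (by omega)) (hxz (n + (d + 1)) (by omega))
      (ih' n (by omega)) (by
        have h' := ih (n + 1) (by omega)
        rw [show n + 1 + d = n + (d + 1) by omega] at h'
        rw [h', pow_succ', mul_inv_cancel_left₀ hq])
    rwa [← pow_succ'] at h

/-- In characteristic zero the Weyl relation has no nonzero finite-dimensional representation. -/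
theorem Module.End.mul_sub_mul_ne_one {k V : Type*} [Field k] [CharZero k] [AddCommGroup V]
    [Module k V] [FiniteDimensional k V] (hV : 0 < Module.finrank k V) (a b : Module.End k V) :
    a * b - b * a ≠ 1 := by
  intro h
  have ht := congrArg (LinearMap.trace k V) h
  rw [map_sub, LinearMap.trace_mul_comm, sub_self, LinearMap.trace_one] at ht
  exact hV.ne' (by exact_mod_cast ht.symm)

theorem stmt5 {k : Type*} [Field k] [IsAlgClosed k] [CharZero k]
    (q : k) (hq : q ≠ 0) (g : ℕ) (hg : 1 ≤ g)
    (V : Type*) [AddCommGroup V] [Module k V] [FiniteDimensional k V]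
    (hV : 0 < Module.finrank k V)
    (x2 : Module.End k V) (z : ℕ → Module.End k V)
    (hzz : ∀ n : ℕ, n < g → z n * z (n + 1) = q⁻¹ • (z (n + 1) * z n))
    (hx2z : ∀ n : ℕ, n < g → x2 * z n = q • (z n * x2) + z (n + 1))
    (hx2zg : x2 * z g = q • (z g * x2))
    (hsimple : ∀ W : Submodule k V,
      (∀ v ∈ W, x2 v ∈ W ∧ ∀ n : ℕ, n ≤ g → z n v ∈ W) → W = ⊥ ∨ W = ⊤) :
    z g = 0 := by
  have hker : ∀ (y : Module.End k V) (c : k), c ≠ 0 → y * z g = c • (z g * y) →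
      ∀ v, z g v = 0 → z g (y v) = 0 := by
    intro y c hc h v hv
    have h1 := LinearMap.congr_fun h v
    simpa [hv, hc] using h1.symm
  rcases hsimple (LinearMap.ker (z g)) (fun v hv => ⟨hker x2 q hq hx2zg v hv, fun n hn => by
    have h := skew_commute_of_adjacent hq hzz hx2z (g - n) n (by omega)
    rw [Nat.add_sub_cancel' hn] at h
    exact hker (z n) _ (pow_ne_zero _ (inv_ne_zero hq)) h v hv⟩) with h | h
  · obtain ⟨u, hu⟩ := (LinearMap.isUnit_iff_ker_eq_bot (z g)).2 h
    obtain ⟨m, rfl⟩ : ∃ m, g = m + 1 := ⟨g - 1, by omega⟩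
    have hrel := hx2z m (by omega)
    rw [← hu] at hrel hx2zg
    have hinv : q • (x2 * ↑u⁻¹) = ↑u⁻¹ * x2 := by
      calc q • (x2 * (↑u⁻¹ : Module.End k V))
          = ↑u⁻¹ * (q • (↑u * x2)) * ↑u⁻¹ := by
            rw [mul_smul_comm, Units.inv_mul_cancel_left, smul_mul_assoc]
        _ = ↑u⁻¹ * x2 := by rw [← hx2zg, ← mul_assoc, Units.mul_inv_cancel_right]
    refine (Module.End.mul_sub_mul_ne_one hV x2 (z m * ↑u⁻¹) ?_).elim
    rw [← mul_assoc, hrel, add_mul, Units.mul_inv, smul_mul_assoc, mul_assoc (z m) x2,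
      mul_assoc (z m) _ x2, ← hinv, mul_smul_comm, add_sub_cancel_left]
  · exact LinearMap.ker_eq_top.1 h
end

section
/- If the algebras B(L_q(1,g)) and B(L_{q'}(1,g')) are isomorphic as (ungraded) k-algebras, then g = g'; moreover, if additionally q has finite order N > 1, then q' also has order N. -/
/-- Defining relations of the Laistrygonian Nichols algebra `B(L_q(1,g))`,
on the free algebra with generators `x₁ = inl 0`, `x₂ = inl 1`,
`z_n = inr n` for `n ∈ {0,…,g}`. -/
inductive LaisRel (k : Type*) [Field k] (q : k) (g : ℕ) :
    FreeAlgebra k (Fin 2 ⊕ Fin (g + 1)) → FreeAlgebra k (Fin 2 ⊕ Fin (g + 1)) → Prop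
  | jordan : LaisRel k q g
      (FreeAlgebra.ι k (Sum.inl 1) * FreeAlgebra.ι k (Sum.inl 0))
      (FreeAlgebra.ι k (Sum.inl 0) * FreeAlgebra.ι k (Sum.inl 1) -
        (1 / 2 : k) • (FreeAlgebra.ι k (Sum.inl 0) * FreeAlgebra.ι k (Sum.inl 0)))
  | x1z0 : LaisRel k q g
      (FreeAlgebra.ι k (Sum.inl 0) * FreeAlgebra.ι k (Sum.inr ⟨0, Nat.succ_pos g⟩))
      (q • (FreeAlgebra.ι k (Sum.inr ⟨0, Nat.succ_pos g⟩) * FreeAlgebra.ι k (Sum.inl 0)))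
  | zz (n : ℕ) (h : n < g) : LaisRel k q g
      (FreeAlgebra.ι k (Sum.inr ⟨n, Nat.lt_succ_of_lt h⟩) *
        FreeAlgebra.ι k (Sum.inr ⟨n + 1, Nat.succ_lt_succ h⟩))
      (q⁻¹ • (FreeAlgebra.ι k (Sum.inr ⟨n + 1, Nat.succ_lt_succ h⟩) *
        FreeAlgebra.ι k (Sum.inr ⟨n, Nat.lt_succ_of_lt h⟩)))
  | x2z (n : ℕ) (h : n < g) : LaisRel k q g
      (FreeAlgebra.ι k (Sum.inl 1) * FreeAlgebra.ι k (Sum.inr ⟨n, Nat.lt_succ_of_lt h⟩))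
      (q • (FreeAlgebra.ι k (Sum.inr ⟨n, Nat.lt_succ_of_lt h⟩) * FreeAlgebra.ι k (Sum.inl 1)) +
        FreeAlgebra.ι k (Sum.inr ⟨n + 1, Nat.succ_lt_succ h⟩))
  | x2zg : LaisRel k q g
      (FreeAlgebra.ι k (Sum.inl 1) * FreeAlgebra.ι k (Sum.inr ⟨g, Nat.lt_succ_self g⟩))
      (q • (FreeAlgebra.ι k (Sum.inr ⟨g, Nat.lt_succ_self g⟩) * FreeAlgebra.ι k (Sum.inl 1)))

/-- The Laistrygonian Nichols algebra `B(L_q(1,g))` as the quotient of the free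
algebra by the defining relations. -/
abbrev Lais (k : Type*) [Field k] (q : k) (g : ℕ) := RingQuot (LaisRel k q g)


namespace Lais

variable {k : Type*} [Field k]

/-- The generator `x₁`. -/
noncomputable def x₁ (q : k) (g : ℕ) : Lais k q g :=
  RingQuot.mkAlgHom k (LaisRel k q g) (FreeAlgebra.ι k (Sum.inl 0))

/-- The generator `x₂`. -/
noncomputable def x₂ (q : k) (g : ℕ) : Lais k q g :=
  RingQuot.mkAlgHom k (LaisRel k q g) (FreeAlgebra.ι k (Sum.inl 1))

/-- The generators `z₀, …, z_g`, extended by zero. -/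
noncomputable def z (q : k) (g n : ℕ) : Lais k q g :=
  if h : n < g + 1 then RingQuot.mkAlgHom k (LaisRel k q g) (FreeAlgebra.ι k (Sum.inr ⟨n, h⟩))
  else 0

variable (q : k) (g : ℕ)

lemma z_eq_zero {n : ℕ} (h : g < n) : z q g n = 0 := by
  rw [z, dif_neg (by omega)]

lemma jordan : x₂ q g * x₁ q g = x₁ q g * x₂ q g - (1 / 2 : k) • (x₁ q g * x₁ q g) := by
  simpa only [x₁, x₂, map_mul, map_sub, map_smul] using
    RingQuot.mkAlgHom_rel k (LaisRel.jordan (k := k) (q := q) (g := g))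

lemma x₁_mul_z_zero : x₁ q g * z q g 0 = q • (z q g 0 * x₁ q g) := by
  rw [z, dif_pos (Nat.succ_pos g)]
  simpa only [x₁, x₂, map_mul, map_sub, map_smul] using
    RingQuot.mkAlgHom_rel k (LaisRel.x1z0 (k := k) (q := q) (g := g))

lemma z_mul_z_succ (n : ℕ) : z q g n * z q g (n + 1) = q⁻¹ • (z q g (n + 1) * z q g n) := by
  by_cases h : n < g
  · rw [z, z, dif_pos (by omega), dif_pos (by omega)]
    simpa only [x₁, x₂, map_mul, map_sub, map_smul] using
      RingQuot.mkAlgHom_rel k (LaisRel.zz (k := k) (q := q) n h)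
  · simp [z_eq_zero q g (show g < n + 1 by omega)]

lemma x₂_mul_z (n : ℕ) : x₂ q g * z q g n = q • (z q g n * x₂ q g) + z q g (n + 1) := by
  rcases lt_trichotomy n g with h | rfl | h
  · rw [z, z, dif_pos (by omega), dif_pos (by omega)]
    simpa only [x₁, x₂, map_mul, map_add, map_smul] using
      RingQuot.mkAlgHom_rel k (LaisRel.x2z (k := k) (q := q) n h)
  · rw [z_eq_zero q n (Nat.lt_succ_self n), add_zero, z, dif_pos (by omega)]
    simpa only [x₁, x₂, map_mul, map_add, map_smul] using
      RingQuot.mkAlgHom_rel k (LaisRel.x2zg (k := k) (q := q) (g := n))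
  · simp [z_eq_zero q g h, z_eq_zero q g (h.trans (Nat.lt_succ_self n))]

lemma z_succ (n : ℕ) : z q g (n + 1) = x₂ q g * z q g n - q • (z q g n * x₂ q g) := by
  rw [x₂_mul_z]; abel

/-- `x₁`, `x₂` and `z₀` generate the algebra. -/
lemma adjoin_eq_top : Algebra.adjoin k {x₁ q g, x₂ q g, z q g 0} = ⊤ := by
  set S := Algebra.adjoin k {x₁ q g, x₂ q g, z q g 0} with hS
  have h1 : x₁ q g ∈ S := Algebra.subset_adjoin (by simp)
  have h2 : x₂ q g ∈ S := Algebra.subset_adjoin (by simp)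
  have hz : ∀ n, z q g n ∈ S := by
    intro n
    induction n with
    | zero => exact Algebra.subset_adjoin (by simp)
    | succ n ih =>
      rw [z_succ]
      exact S.sub_mem (S.mul_mem h2 ih) (S.smul_mem (S.mul_mem ih h2) q)
  refine Algebra.eq_top_iff.2 fun a => ?_
  obtain ⟨b, rfl⟩ := RingQuot.mkAlgHom_surjective k (LaisRel k q g) a
  induction b using FreeAlgebra.induction with
  | grade0 r => rw [AlgHom.commutes]; exact S.algebraMap_mem r
  | grade1 i =>
    rcases i with i | ⟨n, hn⟩
    · fin_cases i
      · exact h1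
      · exact h2
    · have := hz n
      rwa [z, dif_pos hn] at this
  | mul a b ha hb => rw [map_mul]; exact S.mul_mem ha hb
  | add a b ha hb => rw [map_add]; exact S.add_mem ha hb

/-- Induction on elements of the algebra, generated by `x₁`, `x₂` and `z₀`. -/
lemma induction {P : Lais k q g → Prop} (h1 : P (x₁ q g)) (h2 : P (x₂ q g)) (hz : P (z q g 0))
    (halg : ∀ c : k, P (algebraMap k _ c)) (hadd : ∀ a b, P a → P b → P (a + b))
    (hmul : ∀ a b, P a → P b → P (a * b)) (a : Lais k q g) : P a := by
  have ha : a ∈ Algebra.adjoin k {x₁ q g, x₂ q g, z q g 0} := by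
    rw [adjoin_eq_top]; trivial
  refine Algebra.adjoin_induction ?_ halg (fun a b _ _ => hadd a b) (fun a b _ _ => hmul a b) ha
  rintro b (rfl | rfl | rfl)
  exacts [h1, h2, hz]

/-- The universal property. -/
lemma exists_algHom {T : Type*} [Ring T] [Algebra k T] (X Y : T) (Z : ℕ → T)
    (hYX : Y * X = X * Y - (1 / 2 : k) • (X * X)) (hXZ : X * Z 0 = q • (Z 0 * X))
    (hZZ : ∀ n, Z n * Z (n + 1) = q⁻¹ • (Z (n + 1) * Z n))
    (hYZ : ∀ n, Y * Z n = q • (Z n * Y) + Z (n + 1)) (hZ : Z (g + 1) = 0) :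
    ∃ φ : Lais k q g →ₐ[k] T, φ (x₁ q g) = X ∧ φ (x₂ q g) = Y ∧ φ (z q g 0) = Z 0 := by
  let f : Fin 2 ⊕ Fin (g + 1) → T := Sum.elim ![X, Y] fun n => Z n
  refine ⟨RingQuot.liftAlgHom k ⟨FreeAlgebra.lift k f, ?_⟩, ?_, ?_, ?_⟩
  · intro a b h
    cases h with
    | jordan => simpa [f] using hYX
    | x1z0 => simpa [f] using hXZ
    | zz n h => simpa [f] using hZZ n
    | x2z n h => simpa [f] using hYZ n
    | x2zg => simpa [f, hZ] using hYZ g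
  · simp [x₁, f]
  · simp [x₂, f]
  · simp [z, f]

lemma mul_mul_mul_eq {T : Type*} [Ring T] [Algebra k T] {q : k} {Y : T} {Z : ℕ → T}
    (hYZ : ∀ n, Y * Z n = q • (Z n * Y) + Z (n + 1)) (n m : ℕ) :
    Y * (Z n * Z m) = q ^ 2 • (Z n * Z m * Y) + q • (Z n * Z (m + 1)) + Z (n + 1) * Z m := by
  rw [← mul_assoc, hYZ, add_mul, smul_mul_assoc, mul_assoc, hYZ, mul_add, mul_smul_comm, smul_add,
    smul_smul, mul_assoc, sq]

/-- All the `z_n` commute up to powers of `q`. -/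
lemma mul_eq_pow_smul_mul {T : Type*} [Ring T] [Algebra k T] {q : k} (hq : q ≠ 0) {Y : T}
    {Z : ℕ → T} (hYZ : ∀ n, Y * Z n = q • (Z n * Y) + Z (n + 1))
    (hZZ : ∀ n, Z n * Z (n + 1) = q⁻¹ • (Z (n + 1) * Z n)) (j : ℕ) :
    ∀ n, Z n * Z (n + j) = q⁻¹ ^ j • (Z (n + j) * Z n) := by
  induction j using Nat.twoStepInduction with
  | zero => simp
  | one => simpa using hZZ
  | more j ih1 ih2 =>
    intro n
    have e1 := mul_mul_mul_eq hYZ n (n + (j + 1))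
    have e2 := mul_mul_mul_eq hYZ (n + (j + 1)) n
    have e3 := ih1 (n + 1)
    rw [show n + 1 + j = n + (j + 1) by ring] at e3
    rw [ih2 n, mul_smul_comm, e2, smul_mul_assoc, e3] at e1
    have e4 : q • (Z n * Z (n + (j + 1) + 1)) =
        q⁻¹ ^ (j + 1) • (Z (n + (j + 1) + 1) * Z n) := by
      have e5 : q⁻¹ ^ (j + 1) * q = q⁻¹ ^ j := by
        rw [pow_succ, mul_assoc, inv_mul_cancel₀ hq, mul_one]
      rw [smul_add, smul_add, smul_smul _ q, e5, smul_comm (q ^ 2)] at e1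
      refine (add_left_cancel (a := q⁻¹ ^ j • (Z (n + (j + 1)) * Z (n + 1)) +
        q⁻¹ ^ (j + 1) • q ^ 2 • (Z (n + (j + 1)) * Z n * Y)) ?_).symm
      simpa only [add_assoc, add_comm, add_left_comm] using e1
    rw [show n + (j + 2) = n + (j + 1) + 1 by ring, pow_succ' q⁻¹ (j + 1), mul_smul, ← e4,
      smul_smul, inv_mul_cancel₀ hq, one_smul]

lemma not_mul_sub_mul_eq_smul_one [CharZero k] {n : Type*} [Fintype n] [DecidableEq n] [Nonempty n]
    (A B : Matrix n n k) {c : k} (hc : c ≠ 0) : A * B - B * A ≠ c • 1 := by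
  intro h
  have := congrArg Matrix.trace h
  rw [Matrix.trace_sub, Matrix.trace_mul_comm, sub_self, Matrix.trace_smul, Matrix.trace_one] at this
  simp [hc] at this

variable {q g} in
/-- A normal element of the image of a surjection onto a matrix algebra is zero or invertible. -/
lemma eq_zero_or_isUnit {n : Type*} [Fintype n] [DecidableEq n]
    {φ : Lais k q g →ₐ[k] Matrix n n k} (hφ : Function.Surjective φ) {W : Matrix n n k}
    (h1 : ∃ b, W * φ (x₁ q g) = b * W) (h2 : ∃ b, W * φ (x₂ q g) = b * W)
    (hz : ∃ b, W * φ (z q g 0) = b * W) : W = 0 ∨ IsUnit W := by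
  have key : ∀ a, ∃ b, W * φ a = b * W := by
    intro a
    induction a using Lais.induction with
    | h1 => exact h1
    | h2 => exact h2
    | hz => exact hz
    | halg c => exact ⟨algebraMap k _ c, by rw [AlgHom.commutes]; exact (Algebra.commutes c W).symm⟩
    | hadd a a' h h' =>
      obtain ⟨b, hb⟩ := h
      obtain ⟨b', hb'⟩ := h'
      exact ⟨b + b', by rw [map_add, mul_add, hb, hb', add_mul]⟩
    | hmul a a' h h' =>
      obtain ⟨b, hb⟩ := h
      obtain ⟨b', hb'⟩ := h'
      exact ⟨b * b', by rw [map_mul, ← mul_assoc, hb, mul_assoc, hb', mul_assoc]⟩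
  by_cases hW : IsUnit W
  · exact Or.inr hW
  left
  rw [Matrix.isUnit_iff_isUnit_det, isUnit_iff_ne_zero, not_not] at hW
  obtain ⟨v, hv, hWv⟩ := Matrix.exists_mulVec_eq_zero_iff.2 hW
  obtain ⟨i, hi⟩ := Function.ne_iff.1 hv
  ext l j
  obtain ⟨a, ha⟩ := hφ (Matrix.single j i 1)
  obtain ⟨b, hb⟩ := key a
  have h := congrArg (fun M => (M.mulVec v) l) hb
  simp only [ha, ← Matrix.mulVec_mulVec, hWv, Matrix.mulVec_zero, Pi.zero_apply] at h
  have h' : (Matrix.single j i (1 : k)).mulVec v = Pi.single j (v i) := by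
    rw [Matrix.single_mulVec]; ext; simp [Function.update_apply, Pi.single_apply]
  rw [h', Matrix.mulVec_single] at h
  exact (by simpa using h : W l j = 0 ∨ v i = 0).resolve_right hi

variable {q g} in
lemma commute_of_generators {T : Type*} [Ring T] [Algebra k T] (φ : Lais k q g →ₐ[k] T) {W : T}
    (h1 : Commute W (φ (x₁ q g))) (h2 : Commute W (φ (x₂ q g))) (hz : Commute W (φ (z q g 0)))
    (a : Lais k q g) : Commute W (φ a) := by
  induction a using Lais.induction with
  | h1 => exact h1
  | h2 => exact h2
  | hz => exact hz
  | halg c => rw [AlgHom.commutes]; exact Algebra.commute_algebraMap_right c W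
  | hadd a b ha hb => rw [map_add]; exact ha.add_right hb
  | hmul a b ha hb => rw [map_mul]; exact ha.mul_right hb

variable {q g} in
lemma pow_card_eq_one_of_surjective [CharZero k] (hq : q ≠ 0) {n : Type*} [Fintype n]
    [DecidableEq n] [Nontrivial n] {φ : Lais k q g →ₐ[k] Matrix n n k}
    (hφ : Function.Surjective φ) : q ≠ 1 ∧ q ^ Fintype.card n = 1 := by
  have hX : φ (x₁ q g) = 0 := by
    have hj := congrArg φ (jordan q g)
    have hxz := congrArg φ (x₁_mul_z_zero q g)
    simp only [map_mul, map_sub, map_smul] at hj hxz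
    refine (eq_zero_or_isUnit hφ ⟨_, rfl⟩ ⟨φ (x₂ q g) + (1 / 2 : k) • φ (x₁ q g), ?_⟩
      ⟨q • φ (z q g 0), ?_⟩).resolve_right ?_
    · rw [add_mul, hj, smul_mul_assoc]; abel
    · rw [hxz, smul_mul_assoc]
    · rintro ⟨u, hu⟩
      rw [← hu] at hj
      refine not_mul_sub_mul_eq_smul_one (φ (x₂ q g)) (↑u⁻¹) (c := 1 / 2) (by norm_num) ?_
      have h := congrArg (fun M => (↑u⁻¹ : Matrix n n k) * M * (↑u⁻¹ : Matrix n n k)) hj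
      simp only [mul_sub, sub_mul, mul_assoc, Units.mul_inv, mul_one, Units.inv_mul_cancel_left,
        mul_smul_comm, smul_mul_assoc] at h
      rw [h]; abel
  have hYZ : ∀ n, φ (x₂ q g) * φ (z q g n) =
      q • (φ (z q g n) * φ (x₂ q g)) + φ (z q g (n + 1)) := fun n => by
    simpa only [map_mul, map_add, map_smul] using congrArg φ (x₂_mul_z q g n)
  have hZZ := mul_eq_pow_smul_mul hq hYZ fun n => by
    simpa only [map_mul, map_smul] using congrArg φ (z_mul_z_succ q g n)
  have hZ : ∀ i n, g < n + 1 + i → φ (z q g (n + 1)) = 0 := by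
    intro i
    induction i with
    | zero => intro n h; rw [z_eq_zero q g h, map_zero]
    | succ i ih =>
      intro n h
      have hc := hYZ (n + 1)
      rw [ih (n + 1) (by omega), add_zero] at hc
      refine (eq_zero_or_isUnit hφ ⟨0, by rw [hX, mul_zero, zero_mul]⟩
        ⟨q⁻¹ • φ (x₂ q g), ?_⟩ ⟨q ^ (n + 1) • φ (z q g 0), ?_⟩).resolve_right ?_
      · rw [smul_mul_assoc, hc, smul_smul, inv_mul_cancel₀ hq, one_smul]
      · have := hZZ (n + 1) 0
        rw [zero_add] at this
        rw [smul_mul_assoc, this, smul_smul, ← mul_pow, mul_inv_cancel₀ hq, one_pow, one_smul]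
      · rintro ⟨u, hu⟩
        have hn := hYZ n
        rw [← hu] at hc hn
        refine not_mul_sub_mul_eq_smul_one (φ (x₂ q g)) (φ (z q g n) * (u⁻¹).val) (c := 1)
          one_ne_zero ?_
        have h := congrArg (fun M => (u⁻¹).val * M * (u⁻¹).val) hc
        simp only [mul_assoc, Units.mul_inv, mul_one, Units.inv_mul_cancel_left,
          mul_smul_comm, smul_mul_assoc] at h
        rw [← mul_assoc, hn, mul_assoc (φ (z q g n)), h]
        simp [add_mul, mul_assoc]
  have hc := hYZ 0
  rw [hZ g 0 (by omega), add_zero] at hc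
  have hcomm : ¬ Commute (φ (x₂ q g)) (φ (z q g 0)) := by
    intro hc
    have key : ∀ a b, Commute (φ a) (φ b) := fun a => commute_of_generators φ
      (by rw [hX]; exact Commute.zero_right _)
      (commute_of_generators φ (by rw [hX]; exact Commute.zero_right _) (Commute.refl _) hc a).symm
      (commute_of_generators φ (by rw [hX]; exact Commute.zero_right _) hc.symm
        (Commute.refl _) a).symm
    obtain ⟨i, j, hij⟩ := exists_pair_ne n
    obtain ⟨a, ha⟩ := hφ (Matrix.single i j 1)
    obtain ⟨b, hb⟩ := hφ (Matrix.single j i 1)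
    have h := key a b
    rw [ha, hb, Commute, SemiconjBy, Matrix.single_mul_single_same,
      Matrix.single_mul_single_same] at h
    have := congrFun (congrFun h i) i
    simp [hij.symm] at this
  refine ⟨fun h => hcomm (hc.trans (by simp [h])), ?_⟩
  have hYu : IsUnit (φ (x₂ q g)) := by
    refine (eq_zero_or_isUnit hφ ⟨0, by rw [hX, mul_zero, zero_mul]⟩ ⟨_, rfl⟩
      ⟨q • φ (z q g 0), by rw [hc, smul_mul_assoc]⟩).resolve_left fun h => hcomm ?_
    rw [h]; exact Commute.zero_left _
  have hZu : IsUnit (φ (z q g 0)) := by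
    refine (eq_zero_or_isUnit hφ ⟨0, by rw [hX, mul_zero, zero_mul]⟩ ⟨q⁻¹ • φ (x₂ q g), ?_⟩
      ⟨_, rfl⟩).resolve_left fun h => hcomm ?_
    · rw [smul_mul_assoc, hc, smul_smul, inv_mul_cancel₀ hq, one_smul]
    · rw [h]; exact Commute.zero_right _
  rw [Matrix.isUnit_iff_isUnit_det, isUnit_iff_ne_zero] at hYu hZu
  have hd := congrArg Matrix.det hc
  rw [Matrix.det_smul, Matrix.det_mul, Matrix.det_mul, mul_comm (φ (z q g 0)).det] at hd
  exact (mul_right_cancel₀ (mul_ne_zero hYu hZu) (by rw [one_mul]; exact hd)).symm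

/-- The clock and shift matrices give a surjection onto a matrix algebra. -/
lemma exists_surjective {q : k} {N : ℕ} (hN : 1 < N) (hq : IsPrimitiveRoot q N) (g : ℕ)
    [NeZero N] : ∃ φ : Lais k q g →ₐ[k] Matrix (ZMod N) (ZMod N) k, Function.Surjective φ := by
  have : Fact (1 < N) := ⟨hN⟩
  let D : Matrix (ZMod N) (ZMod N) k := Matrix.diagonal fun i => q ^ i.val
  let P : Matrix (ZMod N) (ZMod N) k := Matrix.of fun i j => if i = j + 1 then 1 else 0
  have hDP : D * P = q • (P * D) := by
    ext i j
    simp only [D, P, Matrix.diagonal_mul, Matrix.smul_apply, Matrix.mul_diagonal, Matrix.of_apply]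
    split_ifs with h
    · rw [h, ZMod.val_add, ZMod.val_one, smul_eq_mul, one_mul, mul_one, ← pow_succ']
      conv_rhs =>
        rw [← Nat.mod_add_div (j.val + 1) N, pow_add, pow_mul, hq.pow_eq_one, one_pow, mul_one]
    · simp
  obtain ⟨φ, -, h2, hz⟩ := exists_algHom q g (0 : Matrix (ZMod N) (ZMod N) k) D
    (fun n => if n = 0 then P else 0) (by simp) (by simp) (by simp)
    (by rintro (_ | n) <;> simp [hDP]) (by simp)
  refine ⟨φ, ?_⟩
  rw [← AlgHom.range_eq_top, Algebra.eq_top_iff]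
  set S := φ.range
  have hD : D ∈ S := ⟨_, h2⟩
  have hP : P ∈ S := ⟨_, by simpa using hz⟩
  have hdiag : ∀ i, Matrix.single i i (1 : k) ∈ S := by
    intro i
    have hprod : ∏ j ∈ Finset.univ.erase i, (q ^ i.val - q ^ j.val) ≠ 0 := by
      refine Finset.prod_ne_zero_iff.2 fun j hj h => (Finset.ne_of_mem_erase hj) ?_
      exact (ZMod.val_injective N (hq.pow_inj (ZMod.val_lt i) (ZMod.val_lt j) (sub_eq_zero.1 h))).symm
    have hmem : ∀ s : Finset (ZMod N),
        Matrix.diagonal (fun l : ZMod N => ∏ j ∈ s, (q ^ l.val - q ^ j.val)) ∈ S := by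
      intro s
      induction s using Finset.induction_on with
      | empty => simp
      | insert j s hj ih =>
        convert S.mul_mem (S.sub_mem hD (S.algebraMap_mem (q ^ j.val))) ih using 1
        rw [Matrix.algebraMap_eq_diagonal, Matrix.diagonal_sub, Matrix.diagonal_mul_diagonal]
        simp [Finset.prod_insert hj]
    have hs : Matrix.single i i (1 : k) = (∏ j ∈ Finset.univ.erase i, (q ^ i.val - q ^ j.val))⁻¹ •
        Matrix.diagonal fun l : ZMod N => ∏ j ∈ Finset.univ.erase i, (q ^ l.val - q ^ j.val) := by
      rw [← Matrix.diagonal_single, ← Matrix.diagonal_smul]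
      congr 1
      ext l
      rcases eq_or_ne l i with rfl | hl
      · simp [inv_mul_cancel₀ hprod]
      · rw [Pi.single_eq_of_ne hl, Pi.smul_apply,
          Finset.prod_eq_zero (f := fun j : ZMod N => q ^ l.val - q ^ j.val)
            (Finset.mem_erase.2 ⟨hl, Finset.mem_univ l⟩) (sub_self _), smul_zero]
    rw [hs]
    exact S.smul_mem (hmem _) _
  have hshift : ∀ (n : ℕ) (j : ZMod N), Matrix.single (j + n) j (1 : k) ∈ S := by
    intro n j
    induction n with
    | zero => simpa using hdiag j
    | succ n ih =>
      convert S.mul_mem hP ih using 1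
      ext a b
      simp only [P, Matrix.mul_apply, Matrix.of_apply, Matrix.single_apply]
      by_cases hb : j = b
      · simp [hb, add_assoc, eq_comm]
      · simp [hb]
  intro M
  rw [Matrix.matrix_eq_sum_single M]
  refine S.sum_mem fun i _ => S.sum_mem fun j _ => ?_
  have := S.smul_mem (hshift (i - j).val j) (M i j)
  simpa using this

open Polynomial

/-- A quotient of the algebra: pairs of a polynomial and a truncated polynomial, with
multiplication `(p, r) (p', r') = (p p', p r' + p'(0) r)`. -/
lemma exists_derivation (q : k) (g : ℕ) : ∃ (α : Lais k q g →ₐ[k] k[X])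
    (ρ : Lais k q g →ₗ[k] k[X] ⧸ Ideal.span {(X : k[X]) ^ (g + 1)}),
    (∀ a b, ρ (a * b) = α a • ρ b + (α b).coeff 0 • ρ a) ∧
    α (x₂ q g) = X ∧ ρ (x₂ q g) = 0 ∧ α (z q g 0) = 0 ∧ ρ (z q g 0) = 1 := by
  set R := k[X] ⧸ Ideal.span {(X : k[X]) ^ (g + 1)}
  obtain ⟨α, α1, α2, αz⟩ := exists_algHom q g (0 : k[X]) X (fun _ => 0) (by simp) (by simp)
    (by simp) (by simp) rfl
  let x : R := algebraMap k[X] R X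
  have hx : x ^ (g + 1) = 0 := by
    rw [← map_pow, Ideal.Quotient.algebraMap_eq, Ideal.Quotient.eq_zero_iff_mem]
    exact Ideal.mem_span_singleton_self _
  obtain ⟨β, β1, β2, βz⟩ := exists_algHom q g (0 : Matrix (Fin 2) (Fin 2) R) !![x, 0; 0, 0]
    (fun n => !![0, x ^ n; 0, 0]) (by simp) (by simp) (by simp)
    (fun n => by simp [pow_succ']) (by ext i j; fin_cases i <;> fin_cases j <;> simp [hx])
  have key : ∀ a, β a 0 0 = algebraMap k[X] R (α a) ∧ β a 1 0 = 0 ∧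
      β a 1 1 = algebraMap k R ((α a).coeff 0) := by
    intro a
    induction a using Lais.induction with
    | h1 => simp [α1, β1]
    | h2 => simp [α2, β2, x]
    | hz => simp [αz, βz]
    | halg c =>
      simp only [AlgHom.commutes, Matrix.algebraMap_matrix_apply]
      simp [IsScalarTower.algebraMap_apply k k[X] R]
    | hadd a b ha hb => simp [ha, hb]
    | hmul a b ha hb => simp [Matrix.mul_apply, Fin.sum_univ_two, ha, hb, mul_coeff_zero]
  let ρ : Lais k q g →ₗ[k] R :=
    { toFun := fun a => β a 0 1
      map_add' := fun a b => by simp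
      map_smul' := fun c a => by simp }
  refine ⟨α, ρ, fun a b => ?_, α2, ?_, αz, ?_⟩
  · change β (a * b) 0 1 = α a • β b 0 1 + (α b).coeff 0 • β a 0 1
    rw [map_mul, Matrix.mul_apply, Fin.sum_univ_two, (key a).1, (key b).2.2]
    refine congrArg₂ (· + ·) (Algebra.smul_def (α a) (β b 0 1)).symm ?_
    exact (mul_comm _ _).trans (Algebra.smul_def ((α b).coeff 0) (β a 0 1)).symm
  · change β _ 0 1 = 0
    simp [β2]
  · change β _ 0 1 = 1
    simp [βz]

lemma not_X_pow_dvd {f h : k[X]} {m n : ℕ} (hn : n < m) (hf : f.coeff 0 = 0)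
    (hf' : f.coeff 1 ≠ 0) (hh : h.coeff 0 ≠ 0) : ¬ X ^ m ∣ f ^ n * h := by
  intro hd
  obtain ⟨f', rfl⟩ := X_dvd_iff.2 hf
  rw [coeff_X_mul] at hf'
  have h1 : X ^ n * X ∣ X ^ n * (f' ^ n * h) := by
    rw [← pow_succ, ← mul_assoc, ← mul_pow]
    exact (pow_dvd_pow X hn).trans hd
  have h2 := (mul_dvd_mul_iff_left (pow_ne_zero n X_ne_zero)).1 h1
  rw [X_dvd_iff, mul_coeff_zero, ← constantCoeff_apply (f' ^ n), map_pow] at h2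
  exact mul_ne_zero (pow_ne_zero n hf') hh h2

lemma le_of_dvd {q : k} (hq : q ≠ 0) {p s r t v : k[X]} {m g : ℕ} (hm : 3 ≤ m)
    (hps : C (1 - q) * p * s = 0) (hpv : X ^ m ∣ (p - C (p.coeff 0)) * v)
    (hsv : X ^ m ∣ (C q * s - C (s.coeff 0)) * v)
    (hpw : X ^ m ∣ (p - C (q * p.coeff 0)) ^ g *
      ((p - C (q * p.coeff 0)) * t - (C q * s - C (s.coeff 0)) * r))
    (hsw : X ^ m ∣ (C q * s - C (s.coeff 0)) *
      ((p - C (q * p.coeff 0)) * t - (C q * s - C (s.coeff 0)) * r))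
    (hrank : ∀ a b : k, a * p.coeff 1 + b * r.coeff 0 = 0 → a * s.coeff 1 + b * t.coeff 0 = 0 →
      b * v.coeff 0 = 0 → a = 0 ∧ b = 0) : m ≤ g + 1 := by
  by_contra! hmg
  have hv : v.coeff 0 = 0 := by
    by_contra hv
    by_cases hp : p.coeff 1 = 0
    · have hs : s.coeff 1 ≠ 0 := fun hs =>
        one_ne_zero (hrank 1 0 (by simp [hp]) (by simp [hs]) (by simp)).1
      rw [X_pow_dvd_iff] at hsv
      have h0 := hsv 0 (by omega)
      simp only [mul_coeff_zero, mul_eq_zero, hv, or_false] at h0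
      have h1 := hsv 1 (by omega)
      rw [mul_coeff_one, h0] at h1
      simp [hv, hq, hs] at h1
    · refine not_X_pow_dvd (n := 1) (m := m) (by omega) ?_ ?_ hv (by simpa using hpv)
      · simp
      · simpa [coeff_C] using hp
  have hdet : p.coeff 1 * t.coeff 0 - r.coeff 0 * s.coeff 1 ≠ 0 := by
    intro hdet
    have h1 := hrank (t.coeff 0) (-s.coeff 1) (by linear_combination hdet) (by ring) (by simp [hv])
    have h2 := hrank (r.coeff 0) (-p.coeff 1) (by ring) (by linear_combination -hdet) (by simp [hv])
    exact one_ne_zero (hrank 1 0 (by simpa using h2.2) (by simpa using h1.2) (by simp)).1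
  rw [mul_eq_zero, mul_eq_zero, C_eq_zero, sub_eq_zero] at hps
  rcases hps with (rfl | rfl) | rfl
  · simp only [one_mul, map_one] at hpw hsw
    set P := p - C (p.coeff 0) with hP
    set S := s - C (s.coeff 0) with hS
    have hP0 : P.coeff 0 = 0 := by simp [hP]
    have hS0 : S.coeff 0 = 0 := by simp [hS]
    have hP1 : P.coeff 1 = p.coeff 1 := by simp [hP]
    have hS1 : S.coeff 1 = s.coeff 1 := by simp [hS]
    obtain ⟨w, hw⟩ : X ∣ P * t - S * r := by
      rw [X_dvd_iff]; simp [mul_coeff_zero, hP0, hS0]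
    have hw0 : w.coeff 0 ≠ 0 := by
      have := congrArg (fun f => coeff f 1) hw
      simp only [coeff_sub, mul_coeff_one, hP0, hS0, hP1, hS1, coeff_X_zero, coeff_X_one] at this
      intro h
      apply hdet
      linear_combination this + h
    have haux : ∀ {f : k[X]} {n : ℕ}, n + 1 < m → f.coeff 0 = 0 → X ^ m ∣ f ^ n * (P * t - S * r) →
        f.coeff 1 = 0 := by
      intro f n hn hf hd
      by_contra hf'
      refine not_X_pow_dvd (m := m - 1) (n := n) (by omega) hf hf' hw0 ?_
      rwa [hw, mul_left_comm, ← Nat.sub_add_cancel (show 1 ≤ m by omega), pow_succ',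
        mul_dvd_mul_iff_left X_ne_zero] at hd
    have h1 := haux hmg hP0 hpw
    have h2 := haux (n := 1) (by omega) hS0 (by simpa using hsw)
    rw [hP1] at h1
    rw [hS1] at h2
    simp [h1, h2] at hdet
  · simp only [coeff_zero, mul_zero, map_zero, sub_zero, zero_mul, zero_sub] at hsw hdet
    rw [mul_neg, dvd_neg, ← mul_assoc, ← sq] at hsw
    have hr : r.coeff 0 ≠ 0 := fun h => hdet (by simp [h])
    have hs : s.coeff 1 ≠ 0 := fun h => hdet (by simp [h])
    refine not_X_pow_dvd (n := 2) (by omega) ?_ ?_ hr hsw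
    · have := X_pow_dvd_iff.1 hsw 0 (by omega)
      rw [mul_coeff_zero, ← constantCoeff_apply (_ ^ 2), map_pow] at this
      simpa [hr] using this
    · simp [hq, hs]
  · simp only [coeff_zero, mul_zero, map_zero, sub_zero, zero_mul] at hpw hdet
    rw [← mul_assoc, ← pow_succ] at hpw
    have ht : t.coeff 0 ≠ 0 := fun h => hdet (by simp [h])
    have hp : p.coeff 1 ≠ 0 := fun h => hdet (by simp [h])
    refine not_X_pow_dvd hmg ?_ ?_ ht hpw
    · have := X_pow_dvd_iff.1 hpw 0 (by omega)
      rw [mul_coeff_zero, ← constantCoeff_apply (_ ^ _), map_pow] at this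
      simpa [ht] using this
    · simpa [coeff_C] using hp

variable {q g} in
lemma le_of_derivation [CharZero k] (hq : q ≠ 0) {m : ℕ} (hm : 3 ≤ m) {I : Ideal k[X]}
    (hI : I = Ideal.span {X ^ m}) (α : Lais k q g →ₐ[k] k[X]) (ρ : Lais k q g →ₗ[k] k[X] ⧸ I)
    (hρ : ∀ a b, ρ (a * b) = α a • ρ b + (α b).coeff 0 • ρ a) {a b : Lais k q g}
    (ha : α a = X) (ha' : ρ a = 0) (hb : α b = 0) (hb' : ρ b = 1) : m ≤ g + 1 := by
  set π := Ideal.Quotient.mk I with hπ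
  have hπ0 : ∀ f, π f = 0 ↔ X ^ m ∣ f := fun f => by
    rw [hπ, Ideal.Quotient.eq_zero_iff_mem, hI, Ideal.mem_span_singleton]
  have hsmul : ∀ f h : k[X], f • π h = π (f * h) := fun _ _ => rfl
  have hsmul' : ∀ (c : k) (h : k[X]), c • π h = π (C c * h) := fun c h => by
    rw [← smul_eq_C_mul]; rfl
  obtain ⟨r, hr⟩ := Ideal.Quotient.mk_surjective (ρ (x₂ q g))
  obtain ⟨t, ht⟩ := Ideal.Quotient.mk_surjective (ρ (z q g 0))
  obtain ⟨v, hv⟩ := Ideal.Quotient.mk_surjective (ρ (x₁ q g))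
  rw [← hπ] at hr ht hv
  set p := α (x₂ q g) with hp
  set s := α (z q g 0) with hs
  have hu : α (x₁ q g) = 0 := by
    have h := congrArg α (jordan q g)
    simp only [map_mul, map_sub, map_smul] at h
    rw [mul_comm, eq_comm, sub_eq_self] at h
    simpa using h
  have hα1 : C (1 - q) * p * s = 0 := by
    have h := congrArg α (z_mul_z_succ q g 0)
    rw [z_succ] at h
    simp only [map_mul, map_sub, map_smul, ← hp, ← hs, smul_eq_C_mul] at h
    have h' : C ((1 - q⁻¹) * (1 - q)) * (p * s * s) = 0 := by
      simp only [map_mul, map_sub, map_one]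
      linear_combination h
    rcases mul_eq_zero.1 h' with h | h
    · have h0 : q = 1 := by
        rw [C_eq_zero, mul_eq_zero, sub_eq_zero, sub_eq_zero, eq_comm, inv_eq_one] at h
        tauto
      simp [h0]
    · have h0 : p * s = 0 := by
        simp only [mul_eq_zero] at h ⊢
        tauto
      rw [mul_assoc, h0, mul_zero]
  have hα : ∀ n, α (z q g (n + 1)) = 0 := by
    intro n
    induction n with
    | zero =>
      rw [z_succ]
      simp only [map_mul, map_sub, map_smul, ← hp, ← hs, smul_eq_C_mul]
      simp only [map_sub, map_one] at hα1
      linear_combination hα1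
    | succ n ih => rw [z_succ, map_sub, map_smul, map_mul, map_mul, ih]; simp
  set w := (p - C (q * p.coeff 0)) * t - (C q * s - C (s.coeff 0)) * r with hw
  have hρz : ∀ n, ρ (z q g (n + 1)) = π ((p - C (q * p.coeff 0)) ^ n * w) := by
    intro n
    induction n with
    | zero =>
      rw [z_succ, map_sub, map_smul, hρ, hρ, ← hr, ← ht, ← hp, ← hs]
      simp only [hsmul, hsmul', ← map_add, ← map_sub]
      congr 1
      simp only [hw, map_mul]
      ring
    | succ n ih =>
      rw [z_succ, map_sub, map_smul, hρ, hρ, ih, hα, ← hr, ← hp]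
      simp only [hsmul, hsmul', ← map_add, ← map_sub]
      congr 1
      simp only [map_mul, coeff_zero, map_zero]
      ring
  refine le_of_dvd hq hm hα1 (v := v) (r := r) (t := t) ?_ ?_ ?_ ?_ ?_
  · have h := congrArg ρ (jordan q g)
    rw [map_sub, map_smul] at h
    simp only [hρ, hu, ← hv, ← hp, ← hr, hsmul, hsmul', ← map_add, ← map_sub] at h
    rw [← sub_eq_zero, ← map_sub, hπ0] at h
    convert h using 1
    simp only [coeff_zero, map_zero]
    ring
  · have h := congrArg ρ (x₁_mul_z_zero q g)
    simp only [map_smul, hρ, hu, ← hv, ← hs, ← ht, hsmul, hsmul', ← map_add] at h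
    rw [eq_comm, ← sub_eq_zero, ← map_sub, hπ0] at h
    convert h using 1
    simp only [coeff_zero, map_zero]
    ring
  · rw [← hπ0, ← hρz, z_eq_zero q g (Nat.lt_succ_self g), map_zero]
  · have h := congrArg ρ (z_mul_z_succ q g 0)
    simp only [map_smul, hρ, hρz, hα, pow_zero, one_mul, ← hs, ← ht, hsmul, hsmul', ← map_add] at h
    rw [← sub_eq_zero, ← map_sub, hπ0] at h
    have h' := h.mul_left (C q)
    convert h' using 1
    have : C q * C q⁻¹ = (1 : k[X]) := by rw [← C_mul, mul_inv_cancel₀ hq, C_1]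
    simp only [coeff_zero, map_zero]
    linear_combination (C (s.coeff 0) * w) * this
  · intro c d h1 h2 h3
    let ε : k[X] ⧸ I →+* k := Ideal.Quotient.lift I constantCoeff fun f hf => by
      rw [hI, Ideal.mem_span_singleton] at hf
      exact X_dvd_iff.1 ((dvd_pow_self X (by omega)).trans hf)
    have hε : ∀ f, ε (π f) = f.coeff 0 := fun f => rfl
    have hε1 : ∀ (f : k[X]) y, ε (f • y) = f.coeff 0 * ε y := fun f y => by
      obtain ⟨y, rfl⟩ := Ideal.Quotient.mk_surjective y
      exact mul_coeff_zero f y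
    have hε2 : ∀ (f : k) y, ε (f • y) = f * ε y := fun f y => by
      obtain ⟨y, rfl⟩ := Ideal.Quotient.mk_surjective y
      rw [← hπ, hsmul', hε, coeff_C_mul, hε]
    have hρ1 : ρ 1 = 0 := by simpa using hρ 1 1
    have key : ∀ a, c * (α a).coeff 1 + d * ε (ρ a) = 0 := by
      intro a
      induction a using Lais.induction with
      | h1 => rw [hu, ← hv, hε, h3]; simp
      | h2 => rw [← hr, hε, h1]
      | hz => rw [← ht, hε, h2]
      | halg e =>
        rw [Algebra.algebraMap_eq_smul_one (A := Lais k q g), map_smul, map_smul, map_one, hρ1]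
        simp [coeff_one]
      | hadd a b ha hb =>
        simp only [map_add, coeff_add]
        linear_combination ha + hb
      | hmul a b ha hb =>
        rw [map_mul, hρ, map_add, hε1, hε2, mul_coeff_one]
        linear_combination (α b).coeff 0 * ha + (α a).coeff 0 * hb
    have hka := key a
    have hkb := key b
    rw [ha, ha'] at hka
    rw [hb, hb'] at hkb
    exact ⟨by simpa using hka, by simpa using hkb⟩

variable {q g} in
lemma le_of_algEquiv [CharZero k] {q' : k} {g' : ℕ} (hq : q ≠ 0) (hg : 1 ≤ g)
    (e : Lais k q g ≃ₐ[k] Lais k q' g') : g' ≤ g := by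
  by_contra! h
  obtain ⟨α, ρ, hρ, hα2, hρ2, hαz, hρz⟩ := exists_derivation q' g'
  have := le_of_derivation hq (by omega) rfl (α.comp e.toAlgHom) (ρ.comp e.toLinearMap)
    (fun a b => by simp [hρ]) (a := e.symm (x₂ q' g')) (b := e.symm (z q' g' 0))
    (by simp [hα2]) (by simp [hρ2]) (by simp [hαz]) (by simp [hρz])
  omega

variable {q g} in
lemma pow_eq_one_of_algEquiv [CharZero k] {q' : k} {g' N : ℕ} (hq' : q' ≠ 0) (hN : 1 < N)
    (hq : IsPrimitiveRoot q N) (e : Lais k q g ≃ₐ[k] Lais k q' g') : q' ≠ 1 ∧ q' ^ N = 1 := by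
  have : NeZero N := ⟨by omega⟩
  have : Fact (1 < N) := ⟨hN⟩
  obtain ⟨φ, hφ⟩ := exists_surjective hN hq g
  have := pow_card_eq_one_of_surjective hq' (φ := φ.comp e.symm.toAlgHom)
    (hφ.comp e.symm.surjective)
  rwa [ZMod.card] at this

end Lais

/-- If `B(L_q(1,g))` and `B(L_{q'}(1,g'))` are isomorphic as `k`-algebras, then
`g = g'`; moreover if `q` has finite order `N > 1`, then `q'` also has order `N`. -/
theorem stmt19 {k : Type*} [Field k] [IsAlgClosed k] [CharZero k]
    (q q' : k) (hq : q ≠ 0) (hq' : q' ≠ 0)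
    (g g' : ℕ) (hg : 1 ≤ g) (hg' : 1 ≤ g')
    (hiso : Nonempty (Lais k q g ≃ₐ[k] Lais k q' g')) :
    g = g' ∧ ∀ N : ℕ, 1 < N → q ^ N = 1 → (∀ m : ℕ, 0 < m → m < N → q ^ m ≠ 1) →
      (q' ^ N = 1 ∧ ∀ m : ℕ, 0 < m → m < N → q' ^ m ≠ 1) := by
  obtain ⟨e⟩ := hiso
  refine ⟨le_antisymm (Lais.le_of_algEquiv hq' hg' e.symm) (Lais.le_of_algEquiv hq hg e), ?_⟩
  intro N hN hqN hmin
  have hprim : IsPrimitiveRoot q N :=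
    IsPrimitiveRoot.mk_of_lt q (by omega) hqN hmin
  obtain ⟨h1, hN'⟩ := Lais.pow_eq_one_of_algEquiv hq' hN hprim e
  have hdvd : orderOf q' ∣ N := orderOf_dvd_of_pow_eq_one hN'
  have hpos : 0 < orderOf q' := Nat.pos_of_dvd_of_pos hdvd (by omega)
  have hlt : 1 < orderOf q' := by
    have := mt orderOf_eq_one_iff.1 h1
    omega
  have hN'' := (Lais.pow_eq_one_of_algEquiv hq hlt (IsPrimitiveRoot.orderOf q') e.symm).2
  refine ⟨hN', fun m hm hmN h => ?_⟩
  have h2 := Nat.le_of_dvd hm (orderOf_dvd_of_pow_eq_one h)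
  exact hmin _ hpos (by omega) hN''
end
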